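/- arXiv:1504.02287 — 3 statements merged into one kernel-verified Lean document; each statement's English description precedes it below -/
import Mathlib

section
/- Let k be an infinite field and 𝒜 a finite-dimensional unital associative k-algebra. Then 𝒜 has only finitely many unital subalgebras if and only if there exists g ∈ 𝒜 with 𝒜 = k[g] (the subalgebra generated by g is all of 𝒜) whose minimal polynomial μ_g over k has the form μ_g = P₁⋯Pₙ·Q^e, where P₁,…,Pₙ, Q are pairwise non-associated irreducible polynomials in k[T], deg Q = 1, and e ∈ {0, 2, 3} (the case e = 0 meaning no factor Q occurs). -/
open Polynomial

theorem finite_subalgebra_of_injective {k A B : Type*} [CommSemiring k] [Semiring A] [Semiring B]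
    [Algebra k A] [Algebra k B] [Finite (Subalgebra k B)] (f : A →ₐ[k] B)
    (hf : Function.Injective f) : Finite (Subalgebra k A) :=
  Finite.of_injective _ (Subalgebra.map_injective hf)

theorem finite_subalgebra_of_surjective {k A B : Type*} [CommSemiring k] [Semiring A] [Semiring B]
    [Algebra k A] [Algebra k B] [Finite (Subalgebra k A)] (f : A →ₐ[k] B)
    (hf : Function.Surjective f) : Finite (Subalgebra k B) :=
  Finite.of_injective (Subalgebra.comap f) fun S T h ↦ by
    ext x
    obtain ⟨a, rfl⟩ := hf x
    exact SetLike.ext_iff.mp h a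

theorem finite_subalgebra_prod {k A K : Type*} [Field k] [Ring A] [Algebra k A]
    [FiniteDimensional k A] [Field K] [Algebra k K] [FiniteDimensional k K]
    [Finite (Subalgebra k A)] [Finite (Subalgebra k K)] : Finite (Subalgebra k (A × K)) := by
  let F : (Subalgebra k A × Subalgebra k K) → Subalgebra k (A × K) := fun p ↦ p.1.prod p.2
  let G : (Σ S : Subalgebra k A, S →ₐ[k] K) → Subalgebra k (A × K) :=
    fun p ↦ (AlgHom.prod p.1.val p.2).range
  have hfin : (Set.range F ∪ Set.range G).Finite :=
    (Set.finite_range F).union (Set.finite_range G)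
  refine Set.finite_univ_iff.mp (hfin.subset fun S _ ↦ ?_)
  by_cases h : ∃ y : K, y ≠ 0 ∧ ((0 : A), y) ∈ S
  · left
    obtain ⟨y, hy, hyS⟩ := h
    have hinv : y⁻¹ ∈ S.map (AlgHom.snd k A K) :=
      (Algebra.IsIntegral.isIntegral y).inv_mem ⟨_, hyS, rfl⟩
    obtain ⟨⟨a, _⟩, haS, rfl : _ = y⁻¹⟩ := hinv
    have h01 : ((0 : A), (1 : K)) ∈ S := by
      have := S.mul_mem hyS haS
      simpa [hy] using this
    refine ⟨(S.map (AlgHom.fst k A K), S.map (AlgHom.snd k A K)), ?_⟩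
    ext ⟨a, b⟩
    constructor
    · rintro ⟨⟨⟨a, b'⟩, h1, rfl⟩, ⟨⟨a', b⟩, h2, rfl⟩⟩
      convert! S.add_mem (S.mul_mem h1 (S.sub_mem S.one_mem h01)) (S.mul_mem h01 h2) using 1
      ext <;> simp
    · intro h
      exact ⟨⟨_, h, rfl⟩, ⟨_, h, rfl⟩⟩
  · right
    push Not at h
    let f : S →ₐ[k] A := (AlgHom.fst k A K).comp S.val
    have hf : Function.Injective f := by
      rw [injective_iff_map_eq_zero]
      rintro ⟨⟨a, b⟩, hS⟩ (rfl : a = 0)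
      by_cases hb : b = 0
      · subst hb; rfl
      · exact absurd hS (h b hb)
    let e := AlgEquiv.ofInjective f hf
    refine ⟨⟨f.range, ((AlgHom.snd k A K).comp S.val).comp e.symm.toAlgHom⟩, ?_⟩
    ext x
    constructor
    · rintro ⟨z, rfl⟩
      obtain ⟨s, rfl⟩ := e.surjective z
      have : (AlgHom.prod f.range.val
        (((AlgHom.snd k A K).comp S.val).comp e.symm.toAlgHom)) (e s) = (s : A × K) := by
        ext <;> simp [e, f]
      exact this ▸ s.2
    · intro hx
      refine ⟨e ⟨x, hx⟩, ?_⟩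
      ext <;> simp [e, f]

theorem finite_subalgebra_of_cube_eq_zero {k A : Type*} [Field k] [CommRing A] [Algebra k A]
    (t : A) (ht : t ^ 3 = 0)
    (hspan : ∀ x : A, ∃ a b c : k, x = algebraMap k A a + b • t + c • t ^ 2) :
    Finite (Subalgebra k A) := by
  have hfin : ({⊤, Algebra.adjoin k {t ^ 2}, ⊥} : Set (Subalgebra k A)).Finite := by simp
  refine Set.finite_univ_iff.mp (hfin.subset fun S _ ↦ ?_)
  have key : ∀ {a b c : k}, algebraMap k A a + b • t + c • t ^ 2 ∈ S → b • t + c • t ^ 2 ∈ S := by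
    intro a b c h
    have := S.sub_mem h (S.algebraMap_mem a)
    rwa [add_assoc, add_sub_cancel_left] at this
  have cancel : ∀ {b : k} {x : A}, b ≠ 0 → b • x ∈ S → x ∈ S := by
    intro b x hb h
    simpa [smul_smul, hb] using S.smul_mem h b⁻¹
  by_cases h1 : ∃ a b c : k, b ≠ 0 ∧ algebraMap k A a + b • t + c • t ^ 2 ∈ S
  · left
    obtain ⟨a, b, c, hb, h⟩ := h1
    have h := key h
    have h2 : t ^ 2 ∈ S := by
      have h' := S.mul_mem h h
      have e : (b • t + c • t ^ 2) * (b • t + c • t ^ 2) = (b * b) • t ^ 2 := by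
        simp only [Algebra.smul_def, map_mul]
        linear_combination (2 * algebraMap k A b * algebraMap k A c
          + algebraMap k A c ^ 2 * t) * ht
      rw [e] at h'
      exact cancel (mul_ne_zero hb hb) h'
    have h3 : t ∈ S := by
      have := S.sub_mem h (S.smul_mem h2 c)
      rw [add_sub_cancel_right] at this
      exact cancel hb this
    rw [eq_top_iff]
    rintro x -
    obtain ⟨a, b, c, rfl⟩ := hspan x
    exact S.add_mem (S.add_mem (S.algebraMap_mem a) (S.smul_mem h3 b)) (S.smul_mem h2 c)
  · push Not at h1
    have hS : ∀ x ∈ S, ∃ a c : k, x = algebraMap k A a + c • t ^ 2 := by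
      intro x hx
      obtain ⟨a, b, c, rfl⟩ := hspan x
      by_cases hb : b = 0
      · exact ⟨a, c, by simp [hb]⟩
      · exact absurd hx (h1 a b c hb)
    right
    by_cases h2 : t ^ 2 ∈ S
    · left
      apply le_antisymm
      · intro x hx
        obtain ⟨a, c, rfl⟩ := hS x hx
        exact Subalgebra.add_mem _ (Subalgebra.algebraMap_mem _ a)
          (Subalgebra.smul_mem _ (Algebra.self_mem_adjoin_singleton k _) c)
      · exact Algebra.adjoin_le (by simpa using h2)
    · right
      rw [Set.mem_singleton_iff, eq_bot_iff]
      intro x hx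
      obtain ⟨a, c, rfl⟩ := hS x hx
      by_cases hc : c = 0
      · rw [hc, zero_smul, add_zero]
        exact Subalgebra.algebraMap_mem _ a
      · refine absurd (cancel hc ?_) h2
        simpa using S.sub_mem hx (S.algebraMap_mem a)

theorem finite_subalgebra_adjoinRoot_of_irreducible {k : Type*} [Field k] {P : k[X]}
    (hP : Irreducible P) : Finite (Subalgebra k (AdjoinRoot P)) := by
  have := Fact.mk hP
  have : FiniteDimensional k (AdjoinRoot P) := (AdjoinRoot.powerBasis hP.ne_zero).finite
  have : Finite (IntermediateField k (AdjoinRoot P)) :=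
    Field.finite_intermediateField_of_exists_primitive_element k _
      ⟨_, IntermediateField.adjoin_root_eq_top P⟩
  exact Finite.of_equiv _ (subalgebraEquivIntermediateField (K := k) (L := AdjoinRoot P)).symm.toEquiv

theorem finite_subalgebra_adjoinRoot_linear_pow {k : Type*} [Field k] {Q : k[X]}
    (hQ : Q.degree = 1) {e : ℕ} (he : e ≤ 3) : Finite (Subalgebra k (AdjoinRoot (Q ^ e))) := by
  refine finite_subalgebra_of_cube_eq_zero (AdjoinRoot.mk (Q ^ e) Q) ?_ fun x ↦ ?_
  · rw [← map_pow, AdjoinRoot.mk_eq_zero]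
    exact pow_dvd_pow Q he
  · obtain ⟨p, rfl⟩ := AdjoinRoot.mk_surjective x
    have hlin : ∀ p : k[X], ∃ (a : k) (q : k[X]), p = C a + Q * q := fun p ↦ by
      have hd : (p % Q).degree ≤ 0 := by
        have h := degree_mod_lt p (q := Q) (by rintro rfl; simp at hQ)
        rw [hQ] at h
        exact Nat.WithBot.lt_one_iff_le_zero.mp h
      refine ⟨(p % Q).coeff 0, p / Q, ?_⟩
      rw [← eq_C_of_degree_le_zero hd, add_comm, EuclideanDomain.div_add_mod]
    obtain ⟨a, q, rfl⟩ := hlin p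
    obtain ⟨b, q, rfl⟩ := hlin q
    obtain ⟨c, q, rfl⟩ := hlin q
    refine ⟨a, b, c, ?_⟩
    have h0 : AdjoinRoot.mk (Q ^ e) Q ^ 3 = 0 := by
      rw [← map_pow, AdjoinRoot.mk_eq_zero]
      exact pow_dvd_pow Q he
    simp only [Algebra.smul_def, AdjoinRoot.algebraMap_eq, map_add, map_mul, AdjoinRoot.mk_C]
    linear_combination AdjoinRoot.mk (Q ^ e) q * h0

theorem finite_subalgebra_adjoinRoot_mul {k : Type*} [Field k] {P R : k[X]} (hP : Irreducible P)
    (hR : R ≠ 0) (hPR : ¬ P ∣ R) [Finite (Subalgebra k (AdjoinRoot R))] :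
    Finite (Subalgebra k (AdjoinRoot (P * R))) := by
  have := Fact.mk hP
  have : FiniteDimensional k (AdjoinRoot P) := (AdjoinRoot.powerBasis hP.ne_zero).finite
  have : FiniteDimensional k (AdjoinRoot R) := (AdjoinRoot.powerBasis hR).finite
  have := finite_subalgebra_adjoinRoot_of_irreducible hP
  have : Finite (Subalgebra k (AdjoinRoot R × AdjoinRoot P)) := finite_subalgebra_prod
  let f : AdjoinRoot (P * R) →ₐ[k] AdjoinRoot R × AdjoinRoot P :=
    (AdjoinRoot.algHomOfDvd k _ _ (dvd_mul_left R P)).prod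
      (AdjoinRoot.algHomOfDvd k _ _ (dvd_mul_right P R))
  refine finite_subalgebra_of_injective f ((injective_iff_map_eq_zero _).mpr fun x hx ↦ ?_)
  obtain ⟨p, rfl⟩ := AdjoinRoot.mk_surjective x
  have hmk : ∀ (T : k[X]) (hT : T ∣ P * R),
      AdjoinRoot.algHomOfDvd k _ _ hT (AdjoinRoot.mk _ p) = AdjoinRoot.mk T p := fun T hT ↦ by
    rw [← AdjoinRoot.aeval_eq, ← aeval_algHom_apply, AdjoinRoot.algHomOfDvd_root,
      AdjoinRoot.aeval_eq]
  have h : AdjoinRoot.mk R p = 0 ∧ AdjoinRoot.mk P p = 0 := by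
    rw [← hmk R (dvd_mul_left R P), ← hmk P (dvd_mul_right P R)]
    exact Prod.ext_iff.mp hx
  rw [AdjoinRoot.mk_eq_zero, AdjoinRoot.mk_eq_zero] at h
  exact AdjoinRoot.mk_eq_zero.mpr (((hP.coprime_iff_not_dvd).mpr hPR).mul_dvd h.2 h.1)

theorem finite_subalgebra_adjoinRoot_prod_mul {k ι : Type*} [Field k] (s : Finset ι)
    {P : ι → k[X]} (hP : ∀ i, Irreducible (P i))
    (hPP : ∀ i j, i ≠ j → ¬ Associated (P i) (P j)) {Q : k[X]} (hQ : Irreducible Q)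
    (hQ1 : Q.degree = 1) (hPQ : ∀ i, ¬ Associated (P i) Q) {e : ℕ} (he : e ≤ 3) :
    Finite (Subalgebra k (AdjoinRoot ((∏ i ∈ s, P i) * Q ^ e))) := by
  classical
  induction s using Finset.induction_on with
  | empty =>
    rw [Finset.prod_empty, one_mul]
    exact finite_subalgebra_adjoinRoot_linear_pow hQ1 he
  | insert j s hj ih =>
    rw [Finset.prod_insert hj, mul_assoc]
    refine finite_subalgebra_adjoinRoot_mul (hP j) (mul_ne_zero
      (Finset.prod_ne_zero_iff.mpr fun i _ ↦ (hP i).ne_zero) (pow_ne_zero _ hQ.ne_zero)) fun h ↦ ?_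
    rcases (hP j).prime.dvd_or_dvd h with h | h
    · obtain ⟨i, hi, hd⟩ := (hP j).prime.exists_mem_finset_dvd h
      exact hPP j i (by rintro rfl; exact hj hi) ((hP j).associated_of_dvd (hP i) hd)
    · exact hPQ j ((hP j).associated_of_dvd hQ ((hP j).prime.dvd_of_dvd_pow h))

theorem finite_subalgebra_of_adjoinRoot_minpoly {k A : Type*} [Field k] [Ring A] [Algebra k A]
    {g : A} (hg : Algebra.adjoin k {g} = ⊤) [Finite (Subalgebra k (AdjoinRoot (minpoly k g)))] :
    Finite (Subalgebra k A) := by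
  let f : AdjoinRoot (minpoly k g) →ₐ[k] A :=
    Ideal.Quotient.liftₐ (Ideal.span {minpoly k g}) (aeval g) fun p hp ↦ by
      obtain ⟨q, rfl⟩ := Ideal.mem_span_singleton.mp hp
      simp
  refine finite_subalgebra_of_surjective f fun x ↦ ?_
  have hx : x ∈ Algebra.adjoin k {g} := hg ▸ Algebra.mem_top
  rw [Algebra.adjoin_singleton_eq_range_aeval] at hx
  obtain ⟨p, rfl⟩ := hx
  exact ⟨AdjoinRoot.mk _ p, rfl⟩

theorem exists_adjoin_singleton_eq_top {k A : Type*} [Field k] [Infinite k] [Ring A] [Algebra k A]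
    [Finite (Subalgebra k A)] : ∃ g : A, Algebra.adjoin k {g} = ⊤ := by
  let V : Set.range (fun g : A ↦ Algebra.adjoin k {g}) → Subspace k A :=
    fun S ↦ Subalgebra.toSubmodule S.1
  have hV : ⋃ i, (V i : Set A) = Set.univ := Set.eq_univ_of_forall fun g ↦
    Set.mem_iUnion.mpr ⟨⟨_, g, rfl⟩, Algebra.self_mem_adjoin_singleton k g⟩
  obtain ⟨⟨_, g, rfl⟩, hg⟩ := Subspace.exists_eq_top_of_iUnion_eq_univ hV
  exact ⟨g, Algebra.toSubmodule_eq_top.mp hg⟩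

theorem mem_adjoin_singleton_of_sq_eq_zero {k A : Type*} [Field k] [Ring A] [Algebra k A] {x y : A}
    (hy : y * y = 0) (hx : x ∈ Algebra.adjoin k {y}) :
    ∃ a b : k, x = algebraMap k A a + b • y := by
  rw [Algebra.adjoin_singleton_eq_range_aeval] at hx
  obtain ⟨p, rfl⟩ := hx
  refine ⟨p.coeff 0, p.divX.coeff 0, ?_⟩
  have h : p = p.divX.divX * (X * X) + C (p.divX.coeff 0) * X + C (p.coeff 0) := by
    conv_lhs => rw [← divX_mul_X_add p, ← divX_mul_X_add p.divX]
    ring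
  have heval := congrArg (aeval y) h
  simpa [hy, Algebra.smul_def, add_comm] using heval

/-- Two elements spanning a square-zero subspace are linearly dependent as soon as there are only
finitely many subalgebras. -/
theorem not_linearIndependent_of_mul_eq_zero {k A : Type*} [Field k] [Infinite k] [Ring A]
    [Algebra k A] [Finite (Subalgebra k A)] {x y : A} (hxx : x * x = 0) (hxy : x * y = 0)
    (hyx : y * x = 0) (hyy : y * y = 0) : ¬ LinearIndependent k ![x, y] := by
  intro hli
  rw [LinearIndependent.pair_iff] at hli
  obtain ⟨c, d, hcd, h⟩ :=
    Finite.exists_ne_map_eq_of_infinite fun c : k ↦ Algebra.adjoin k {x + c • y}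
  have hsq : ∀ c d : k, (x + c • y) * (x + d • y) = 0 := fun c d ↦ by
    simp [mul_add, add_mul, hxx, hxy, hyx, hyy]
  obtain ⟨a, b, hab⟩ := mem_adjoin_singleton_of_sq_eq_zero (k := k) (hsq d d)
    ((SetLike.ext_iff.mp h _).mp (Algebra.self_mem_adjoin_singleton k (x + c • y)))
  have hx0 : x ≠ 0 := by
    rintro rfl
    exact one_ne_zero (hli 1 0 (by simp)).1
  have ha : a = 0 := by
    have h1 := congrArg (· * (x + d • y)) hab
    simp only [hsq, add_mul, smul_mul_assoc, smul_zero, add_zero, ← Algebra.smul_def] at h1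
    by_contra ha
    have h2 := hli a (a * d) (by rw [mul_smul, ← smul_add]; exact h1.symm)
    exact ha h2.1
  rw [ha, map_zero, zero_add] at hab
  have h3 := hli (1 - b) (c - b * d) (by
    rw [sub_smul, sub_smul, one_smul, mul_smul]
    rw [smul_add] at hab
    rw [sub_add_sub_comm, hab, sub_self])
  have hb : b = 1 := (sub_eq_zero.mp h3.1).symm
  rw [hb, one_mul] at h3
  exact hcd (sub_eq_zero.mp h3.2)

theorem natDegree_le_one_of_mul_self_dvd_minpoly {k A : Type*} [Field k] [Infinite k] [Ring A]
    [Algebra k A] [Finite (Subalgebra k A)] {g : A} (hg : IsIntegral k g) {m : k[X]}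
    (hm : m * m ∣ minpoly k g) : m.natDegree ≤ 1 := by
  by_contra! hdeg
  obtain ⟨r, hr⟩ := hm
  have hmr : m * r ≠ 0 := by
    intro h
    exact minpoly.ne_zero hg (by rw [hr, mul_assoc, h, mul_zero])
  have hzero : ∀ u : k[X], aeval g (m * r * (m * r) * u) = 0 := fun u ↦ by
    rw [show m * r * (m * r) * u = minpoly k g * (r * u) by rw [hr]; ring]
    simp
  have hmul : ∀ u v w : k[X], u * v = m * r * (m * r) * w → aeval g u * aeval g v = 0 :=
    fun u v w h ↦ by rw [← map_mul, h, hzero]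
  refine not_linearIndependent_of_mul_eq_zero (k := k) (x := aeval g (m * r))
    (y := aeval g (X * (m * r))) (hmul _ _ 1 (by ring)) (hmul _ _ X (by ring))
    (hmul _ _ X (by ring)) (hmul _ _ (X * X) (by ring)) ?_
  rw [LinearIndependent.pair_iff]
  intro a b hab
  have h0 : aeval g ((C b * X + C a) * (m * r)) = 0 := by
    rw [← hab]
    simp [Algebra.smul_def, add_mul, add_comm, mul_assoc]
  have hdvd : m ∣ C b * X + C a := by
    have := minpoly.dvd k g h0
    rw [hr, mul_assoc] at this
    exact (mul_dvd_mul_iff_right hmr).mp this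
  have hlin : C b * X + C a = 0 := eq_zero_of_dvd_of_natDegree_lt hdvd
    (natDegree_linear_le.trans_lt hdeg)
  exact ⟨by simpa using congrArg (coeff · 0) hlin, by simpa using congrArg (coeff · 1) hlin⟩

open UniqueFactorizationMonoid in
theorem exists_fin_prod_irreducible_of_squarefree {k : Type*} [Field k] {r : k[X]} (hr : r.Monic)
    (hsq : Squarefree r) : ∃ (n : ℕ) (P : Fin n → k[X]), (∀ i, Irreducible (P i)) ∧
      (∀ i j, i ≠ j → ¬ Associated (P i) (P j)) ∧ r = ∏ i, P i := by
  classical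
  have hnd := (squarefree_iff_nodup_normalizedFactors hr.ne_zero).mp hsq
  let s : Finset k[X] := ⟨normalizedFactors r, hnd⟩
  have hs : ∀ i : Fin s.card, (s.equivFin.symm i : k[X]) ∈ normalizedFactors r :=
    fun i ↦ (s.equivFin.symm i).2
  refine ⟨s.card, fun i ↦ s.equivFin.symm i, fun i ↦ irreducible_of_normalized_factor _ (hs i),
    fun i j hij h ↦ hij ?_, ?_⟩
  · exact s.equivFin.symm.injective
      (Subtype.ext (normalizedFactors_eq_of_dvd r _ (hs i) _ (hs j) h.dvd))
  · rw [Equiv.prod_comp s.equivFin.symm (fun x : s ↦ (x : k[X])), Finset.prod_coe_sort s fun x ↦ x]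
    have : (normalizedFactors r).prod = r := by
      rw [prod_normalizedFactors_eq hr.ne_zero, hr.normalize_eq_self]
    rw [Finset.prod_eq_multiset_prod, Multiset.map_id']
    exact this.symm

theorem exists_factorization_of_natDegree_le_one {k : Type*} [Field k] [Infinite k] {f : k[X]}
    (hf : f.Monic) (h : ∀ m : k[X], m * m ∣ f → m.natDegree ≤ 1) :
    ∃ (n : ℕ) (P : Fin n → k[X]) (Q : k[X]) (e : ℕ),
      (∀ i, Irreducible (P i)) ∧ Irreducible Q ∧ Q.degree = 1 ∧
      (∀ i j, i ≠ j → ¬ Associated (P i) (P j)) ∧ (∀ i, ¬ Associated (P i) Q) ∧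
      (e = 0 ∨ e = 2 ∨ e = 3) ∧ f = (∏ i, P i) * Q ^ e := by
  by_cases hsq : Squarefree f
  · obtain ⟨n, P, hP, hPP, hprod⟩ := exists_fin_prod_irreducible_of_squarefree hf hsq
    obtain ⟨c, hc⟩ : ∃ c, f.eval c ≠ 0 := by
      by_contra! hc
      exact hf.ne_zero (zero_of_eval_zero f hc)
    refine ⟨n, P, X - C c, 0, hP, irreducible_X_sub_C c, degree_X_sub_C c, hPP, fun i hi ↦ hc ?_,
      Or.inl rfl, by rw [pow_zero, mul_one, hprod]⟩
    exact dvd_iff_isRoot.mp (hi.symm.dvd.trans (hprod ▸ Finset.dvd_prod_of_mem P (Finset.mem_univ i)))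
  · have hex : ∃ q : k[X], Irreducible q ∧ q * q ∣ f := by
      by_contra! hex
      exact hsq ((squarefree_iff_irreducible_sq_not_dvd_of_ne_zero hf.ne_zero).mpr hex)
    obtain ⟨Q, hQ, hQm, hQf⟩ : ∃ Q : k[X], Irreducible Q ∧ Q.Monic ∧ Q * Q ∣ f := by
      classical
      obtain ⟨q, hq, hqf⟩ := hex
      exact ⟨normalize q, (normalize_associated q).symm.irreducible hq,
        monic_normalize hq.ne_zero,
        ((normalize_associated q).mul_mul (normalize_associated q)).dvd.trans hqf⟩
    have hQ1 : Q.natDegree = 1 := le_antisymm (h Q hQf) hQ.natDegree_pos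
    have hfin : FiniteMultiplicity Q f := FiniteMultiplicity.of_not_isUnit hQ.not_isUnit hf.ne_zero
    obtain ⟨r, hr, hQr⟩ := hfin.exists_eq_pow_mul_and_not_dvd
    set e := multiplicity Q f
    have he2 : 2 ≤ e := hfin.le_multiplicity_of_pow_dvd (by rwa [pow_two])
    have he3 : e ≤ 3 := by
      by_contra! he
      have h4 : (Q * Q) * (Q * Q) ∣ f := by
        rw [hr, show Q * Q * (Q * Q) = Q ^ 4 by ring]
        exact (pow_dvd_pow Q he).mul_right r
      have := h _ h4
      rw [hQm.natDegree_mul hQm, hQ1] at this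
      omega
    have hrm : r.Monic := (hQm.pow e).of_mul_monic_left (hr ▸ hf)
    have hrsq : Squarefree r := by
      rw [squarefree_iff_irreducible_sq_not_dvd_of_ne_zero hrm.ne_zero]
      intro m hm hmr
      have hd : (Q * m) * (Q * m) ∣ f := by
        rw [hr, show Q * m * (Q * m) = Q ^ 2 * (m * m) by ring]
        exact mul_dvd_mul (pow_dvd_pow Q he2) hmr
      have := h _ hd
      rw [natDegree_mul hQ.ne_zero hm.ne_zero, hQ1] at this
      have := hm.natDegree_pos
      omega
    obtain ⟨n, P, hP, hPP, hprod⟩ := exists_fin_prod_irreducible_of_squarefree hrm hrsq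
    refine ⟨n, P, Q, e, hP, hQ, (degree_eq_iff_natDegree_eq_of_pos one_pos).mpr hQ1, hPP,
      fun i hi ↦ hQr ?_, by omega, by rw [← hprod, mul_comm, ← hr]⟩
    exact hi.symm.dvd.trans (hprod ▸ Finset.dvd_prod_of_mem P (Finset.mem_univ i))

theorem stmt_11 {k A : Type*} [Field k] [Infinite k] [Ring A] [Algebra k A]
    [FiniteDimensional k A] :
    Finite (Subalgebra k A) ↔
      ∃ (g : A) (n : ℕ) (P : Fin n → Polynomial k) (Q : Polynomial k) (e : ℕ),
        Algebra.adjoin k {g} = ⊤ ∧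
        (∀ i, Irreducible (P i)) ∧ Irreducible Q ∧ Q.degree = 1 ∧
        (∀ i j, i ≠ j → ¬ Associated (P i) (P j)) ∧
        (∀ i, ¬ Associated (P i) Q) ∧
        (e = 0 ∨ e = 2 ∨ e = 3) ∧
        minpoly k g = (∏ i, P i) * Q ^ e := by
  constructor
  · intro hfin
    obtain ⟨g, hg⟩ := exists_adjoin_singleton_eq_top (k := k) (A := A)
    have hint : IsIntegral k g := .of_finite k g
    obtain ⟨n, P, Q, e, h⟩ := exists_factorization_of_natDegree_le_one (minpoly.monic hint)
      fun m hm ↦ natDegree_le_one_of_mul_self_dvd_minpoly hint hm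
    exact ⟨g, n, P, Q, e, hg, h⟩
  · rintro ⟨g, n, P, Q, e, hg, hP, hQ, hQ1, hPP, hPQ, he, hmin⟩
    have := finite_subalgebra_adjoinRoot_prod_mul Finset.univ hP hPP hQ hQ1 hPQ
      (show e ≤ 3 by omega)
    rw [← hmin] at this
    exact finite_subalgebra_of_adjoinRoot_minpoly hg
end

section
/- Let k be an infinite field and 𝒜 a commutative finite-dimensional unital k-algebra having only finitely many unital subalgebras. Let A and B be finite nonempty subsets of 𝒜∖{0} such that k⟨A⟩ and k⟨B⟩ each contain an invertible element of 𝒜, and let ℋ = {h ∈ 𝒜 : h·k⟨AB⟩ ⊆ k⟨AB⟩} be the stabilizer subalgebra of k⟨AB⟩. Then dim_k k⟨AB⟩ ≥ dim_k k⟨ℋA⟩ + dim_k k⟨ℋB⟩ − dim_k ℋ ≥ dim_k k⟨A⟩ + dim_k k⟨B⟩ − dim_k ℋ. -/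
open Pointwise

/-- In a finite-dimensional commutative algebra, a line through a unit contains only finitely many
non-units. -/
theorem finite_setOf_not_isUnit_add_smul {k A : Type*} [Field k] [CommRing A] [Algebra k A]
    [FiniteDimensional k A] (b : A) {u : A} (hu : IsUnit u) :
    {c : k | ¬ IsUnit (b + c • u)}.Finite := by
  obtain ⟨u, rfl⟩ := hu
  have hf := Module.End.finite_spectrum (LinearMap.mulLeft k (-(b * (↑u⁻¹ : A))))
  refine hf.subset fun c hc => ?_
  rw [spectrum.mem_iff]
  intro h
  refine hc ?_
  obtain ⟨x, hx⟩ := ((Module.End.isUnit_iff _).1 h).2 1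
  refine IsUnit.of_mul_eq_one (x * (↑u⁻¹ : A)) ?_
  have hx' : c • x + b * (↑u⁻¹ : A) * x = 1 := by
    simpa [LinearMap.sub_apply] using hx
  have huu : (u : A) * (↑u⁻¹ : A) = 1 := u.mul_inv
  rw [Algebra.smul_def] at hx' ⊢
  linear_combination hx' + algebraMap k A c * x * huu

/-- The stabilizer of a subspace of a commutative algebra, as a subalgebra. -/
def Submodule.stabilizerSubalgebra {k A : Type*} [Field k] [CommRing A] [Algebra k A]
    (Q : Submodule k A) : Subalgebra k A where
  carrier := {h | ∀ x ∈ Q, h * x ∈ Q}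
  mul_mem' ha hb x hx := by
    rw [mul_assoc]
    exact ha _ (hb _ hx)
  add_mem' ha hb x hx := by
    rw [add_mul]
    exact Q.add_mem (ha x hx) (hb x hx)
  algebraMap_mem' r x hx := by
    rw [← Algebra.smul_def]
    exact Q.smul_mem r hx

theorem Submodule.finrank_map_mulLeft {k A : Type*} [Field k] [CommRing A] [Algebra k A]
    {a : A} (ha : IsUnit a) (P : Submodule k A) :
    Module.finrank k (P.map (LinearMap.mulLeft k a)) = Module.finrank k P :=
  ((Submodule.equivMapOfInjective _ (fun _ _ h => ha.mul_left_cancel h) P).finrank_eq).symm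

/-- Diderrich's local inequality, proved by the linear Dyson transform. -/
theorem exists_subalgebra_mul_mem_of_isUnit {k A : Type*} [Field k] [Infinite k] [CommRing A]
    [Algebra k A] [FiniteDimensional k A] {a : A} (ha : IsUnit a) (P Q : Submodule k A)
    (haP : a ∈ P) (hQ : ∃ x ∈ Q, IsUnit x) :
    ∃ H : Subalgebra k A, (∀ x ∈ H.toSubmodule * Q, a * x ∈ P * Q) ∧
      Module.finrank k P + Module.finrank k Q ≤
        Module.finrank k ↥(P * Q) + Module.finrank k H := by
  induction hn : Module.finrank k P using Nat.strong_induction_on generalizing P Q with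
  | _ n ih =>
  subst hn
  obtain ⟨a', ha'⟩ := ha.exists_right_inv
  have haU' : IsUnit a' := IsUnit.of_mul_eq_one a (by rw [mul_comm, ha'])
  by_cases hT : ∀ e ∈ Q, IsUnit e → ∀ p ∈ P, a' * e * p ∈ Q
  · obtain ⟨u, huQ, hu⟩ := hQ
    have hall : ∀ b ∈ Q, ∀ p ∈ P, a' * b * p ∈ Q := by
      intro b hb p hp
      obtain ⟨c, hc⟩ := (finite_setOf_not_isUnit_add_smul (k := k) b hu).exists_notMem
      have hc : IsUnit (b + c • u) := not_not.1 hc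
      have h1 := hT _ (Q.add_mem hb (Q.smul_mem c huQ)) hc p hp
      have h2 := Q.smul_mem c (hT u huQ hu p hp)
      have h3 := Q.sub_mem h1 h2
      convert h3 using 1
      simp only [Algebra.smul_def]
      ring
    refine ⟨Q.stabilizerSubalgebra, fun x hx => ?_, ?_⟩
    · have hle : Q.stabilizerSubalgebra.toSubmodule * Q ≤ Q :=
        Submodule.mul_le.2 fun m hm n hn => hm n hn
      exact Submodule.mul_mem_mul haP (hle hx)
    · have h1 : Module.finrank k P ≤ Module.finrank k Q.stabilizerSubalgebra := by
        rw [← Submodule.finrank_map_mulLeft haU' P]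
        refine Submodule.finrank_mono (t := Q.stabilizerSubalgebra.toSubmodule) ?_
        rintro _ ⟨p, hp, rfl⟩ q hq
        have := hall q hq p hp
        rwa [mul_right_comm] at this
      have h2 : Module.finrank k Q ≤ Module.finrank k ↥(P * Q) := by
        rw [← Submodule.finrank_map_mulLeft ha Q]
        refine Submodule.finrank_mono ?_
        rintro _ ⟨q, hq, rfl⟩
        exact Submodule.mul_mem_mul haP hq
      omega
  · push Not at hT
    obtain ⟨e, heQ, he, p, hpP, hp⟩ := hT
    set f := LinearMap.mulLeft k (a' * e) with hf
    have hc : IsUnit (a' * e) := haU'.mul he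
    have hmap : (P ⊓ Q.comap f).map f = Q ⊓ P.map f := by
      ext x
      constructor
      · rintro ⟨y, ⟨hyP, hyQ⟩, rfl⟩
        exact ⟨hyQ, y, hyP, rfl⟩
      · rintro ⟨hx, y, hyP, rfl⟩
        exact ⟨y, ⟨hyP, hx⟩, rfl⟩
    have hdim : Module.finrank k ↥(P ⊓ Q.comap f) + Module.finrank k ↥(Q ⊔ P.map f) =
        Module.finrank k P + Module.finrank k Q := by
      have h1 := Submodule.finrank_map_mulLeft hc (P ⊓ Q.comap f)
      have h2 := Submodule.finrank_map_mulLeft hc P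
      have h3 := Submodule.finrank_sup_add_finrank_inf_eq Q (P.map f)
      rw [← hf, hmap] at h1
      rw [← hf] at h2
      omega
    have hlt : Module.finrank k ↥(P ⊓ Q.comap f) < Module.finrank k P := by
      refine Submodule.finrank_lt_finrank_of_lt (lt_of_le_of_ne inf_le_left fun h => hp ?_)
      rw [← h] at hpP
      exact hpP.2
    have hle : (P ⊓ Q.comap f) * (Q ⊔ P.map f) ≤ P * Q := by
      rw [Submodule.mul_sup]
      refine sup_le (mul_le_mul' inf_le_left le_rfl) (Submodule.mul_le.2 ?_)
      rintro x ⟨_, hxQ⟩ _ ⟨y, hy, rfl⟩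
      have h := Submodule.mul_mem_mul hy (show f x ∈ Q from hxQ)
      convert h using 1
      simp only [hf, LinearMap.mulLeft_apply]
      ring
    have haf : a ∈ P ⊓ Q.comap f := by
      refine ⟨haP, ?_⟩
      have : f a = e := by
        simp only [hf, LinearMap.mulLeft_apply]
        linear_combination e * ha'
      exact show f a ∈ Q from this.symm ▸ heQ
    obtain ⟨H, hH, hd⟩ := ih _ hlt (P ⊓ Q.comap f) (Q ⊔ P.map f) haf
      ⟨e, le_sup_left (a := Q) heQ, he⟩ rfl
    have hHQ : H.toSubmodule * Q ≤ H.toSubmodule * (Q ⊔ P.map f) :=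
      mul_le_mul' le_rfl le_sup_left
    refine ⟨H, fun x hx => hle (hH x (hHQ hx)), ?_⟩
    have := Submodule.finrank_mono hle
    omega

/-- Kneser's inequality for subspaces, with respect to some subalgebra stabilizing the product. -/
theorem exists_subalgebra_mul_le_and_finrank_le {k A : Type*} [Field k] [Infinite k] [CommRing A]
    [Algebra k A] [FiniteDimensional k A] [Finite (Subalgebra k A)] (P Q : Submodule k A)
    (hP : ∃ x ∈ P, IsUnit x) (hQ : ∃ x ∈ Q, IsUnit x) :
    ∃ H : Subalgebra k A, H.toSubmodule * (P * Q) ≤ P * Q ∧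
      Module.finrank k P + Module.finrank k Q ≤
        Module.finrank k ↥(P * Q) + Module.finrank k H := by
  obtain ⟨u, huP, hu⟩ := hP
  let ι := {H : Subalgebra k A // Module.finrank k P + Module.finrank k Q ≤
        Module.finrank k ↥(P * Q) + Module.finrank k H}
  let W : ι → Submodule k A := fun H => (P * Q) / (H.1.toSubmodule * Q)
  have hunit : ∀ a ∈ P, IsUnit a → ∃ i, a ∈ W i := fun a haP ha => by
    obtain ⟨H, h1, h2⟩ := exists_subalgebra_mul_mem_of_isUnit ha P Q haP hQ
    exact ⟨⟨H, h2⟩, Submodule.mem_div_iff_forall_mul_mem.2 h1⟩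
  have hcover : ∀ b ∈ P, ∃ i, b ∈ W i := by
    intro b hb
    have hinf := (finite_setOf_not_isUnit_add_smul (k := k) b hu).infinite_compl
    have := hinf.to_subtype
    have hw : ∀ c : ({c : k | ¬ IsUnit (b + c • u)}ᶜ : Set k), ∃ i, b + c.1 • u ∈ W i :=
      fun c => hunit _ (P.add_mem hb (P.smul_mem _ huP)) (not_not.1 c.2)
    choose g hg using hw
    obtain ⟨c, d, hcd, hgcd⟩ := Finite.exists_ne_map_eq_of_infinite g
    have hcd' : c.1 - d.1 ≠ 0 := sub_ne_zero.2 fun h => hcd (Subtype.ext h)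
    have hc := hg c
    have hd := hg d
    rw [← hgcd] at hd
    have huW : u ∈ W (g c) := by
      have h := (W (g c)).sub_mem hc hd
      rw [add_sub_add_left_eq_sub, ← sub_smul] at h
      exact ((W (g c)).smul_mem_iff hcd').1 h
    exact ⟨g c, ((W (g c)).add_mem_iff_left ((W (g c)).smul_mem _ huW)).1 hc⟩
  obtain ⟨i, hi⟩ := Subspace.exists_eq_top_of_iUnion_eq_univ
    (p := fun i => (W i).comap P.subtype) (by
      refine Set.eq_univ_of_forall fun b => Set.mem_iUnion.2 ?_
      exact hcover b b.2)
  have hPW : P ≤ W i := Submodule.comap_subtype_eq_top.1 hi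
  refine ⟨i.1, ?_, i.2⟩
  rw [mul_left_comm]
  exact Submodule.le_div_iff_mul_le.1 hPW

theorem stmt_13 {k A : Type*} [Field k] [Infinite k] [CommRing A] [Algebra k A]
    [FiniteDimensional k A] (hfin : Finite (Subalgebra k A))
    (S T : Set A) (hSfin : S.Finite) (hTfin : T.Finite)
    (hSne : S.Nonempty) (hTne : T.Nonempty)
    (hS0 : (0 : A) ∉ S) (hT0 : (0 : A) ∉ T)
    (hSu : ∃ x ∈ Submodule.span k S, IsUnit x) (hTu : ∃ x ∈ Submodule.span k T, IsUnit x)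
    (H : Subalgebra k A)
    (hH : ∀ h : A, h ∈ H ↔
      ∀ x ∈ Submodule.span k (S * T), h * x ∈ Submodule.span k (S * T)) :
    Module.finrank k (Submodule.span k ((H : Set A) * S)) +
        Module.finrank k (Submodule.span k ((H : Set A) * T)) ≤
      Module.finrank k (Submodule.span k (S * T)) + Module.finrank k H ∧
    Module.finrank k (Submodule.span k S) + Module.finrank k (Submodule.span k T) ≤
      Module.finrank k (Submodule.span k ((H : Set A) * S)) +
        Module.finrank k (Submodule.span k ((H : Set A) * T)) := by
  have hspan : ∀ R : Set A, Submodule.span k ((H : Set A) * R) =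
      H.toSubmodule * Submodule.span k R := fun R => by
    rw [← Submodule.span_mul_span]
    congr 1
    exact Submodule.span_eq H.toSubmodule
  have hle : ∀ R : Submodule k A, R ≤ H.toSubmodule * R := fun R x hx => by
    have h := Submodule.mul_mem_mul (show (1 : A) ∈ H.toSubmodule from H.one_mem) hx
    rwa [one_mul] at h
  rw [hspan, hspan]
  refine ⟨?_, add_le_add (Submodule.finrank_mono (hle _)) (Submodule.finrank_mono (hle _))⟩
  rw [← Submodule.span_mul_span] at hH ⊢
  set P := Submodule.span k S
  set Q := Submodule.span k T
  have hHPQ : H.toSubmodule * (P * Q) = P * Q :=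
    le_antisymm (Submodule.mul_le.2 fun h hh x hx => (hH h).1 hh x hx) (hle _)
  have hprod : H.toSubmodule * P * (H.toSubmodule * Q) = P * Q := by
    rw [mul_mul_mul_comm, mul_assoc, hHPQ, hHPQ]
  obtain ⟨K, hK, hd⟩ := exists_subalgebra_mul_le_and_finrank_le
    (H.toSubmodule * P) (H.toSubmodule * Q)
    (hSu.imp fun x hx => ⟨hle _ hx.1, hx.2⟩) (hTu.imp fun x hx => ⟨hle _ hx.1, hx.2⟩)
  rw [hprod] at hK hd
  have hKH : K.toSubmodule ≤ H.toSubmodule := fun h hh =>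
    (hH h).2 fun x hx => hK (Submodule.mul_mem_mul hh hx)
  have hKd : Module.finrank k K ≤ Module.finrank k H := Submodule.finrank_mono hKH
  omega
end

section
/- Let k be an infinite field, 𝒜 a finite-dimensional unital associative k-algebra, and A, B finite subsets of 𝒜∖{0} such that the elements of A pairwise commute and k⟨A⟩ and k⟨B⟩ each contain an invertible element of 𝒜. Then for each invertible element a ∈ k⟨A⟩, there exist a commutative unital subalgebra 𝒜ₐ of 𝒜 with k ⊆ 𝒜ₐ ⊆ 𝔸(A), and a k-vector subspace Vₐ of k⟨AB⟩, such that Vₐ contains an invertible element of 𝒜, 𝒜ₐ·Vₐ = Vₐ, k⟨aB⟩ ⊆ Vₐ, and dim_k Vₐ + dim_k 𝒜ₐ ≥ dim_k k⟨A⟩ + dim_k k⟨B⟩. -/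
open Pointwise

section

variable {k A : Type*} [Field k] [Ring A] [Algebra k A] [FiniteDimensional k A]

theorem spectrum_finite_of_finiteDimensional (x : A) : (spectrum k x).Finite := by
  refine (Module.End.finite_spectrum (Algebra.lmul k A x)).subset fun t ht h => ht ?_
  rw [spectrum.mem_resolventSet_iff] at h ⊢
  rw [← Algebra.lmul_isUnit_iff (R := k)]
  simpa [map_sub, AlgHom.commutes] using h

theorem exists_isUnit_add_smul [Infinite k] (x : A) {u : A} (hu : IsUnit u) :
    ∃ t : k, IsUnit (x + t • u) := by
  obtain ⟨u, rfl⟩ := hu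
  obtain ⟨t, ht⟩ := (spectrum_finite_of_finiteDimensional (k := k) (-(x * ↑u⁻¹))).exists_notMem
  refine ⟨t, ?_⟩
  rw [spectrum.notMem_iff] at ht
  have h := ht.mul u.isUnit
  rwa [sub_neg_eq_add, add_mul, mul_assoc, Units.inv_mul, mul_one, ← Algebra.smul_def,
    add_comm] at h

theorem Subalgebra.units_inv_mem_of_mem (D : Subalgebra k A) (u : Aˣ) (hu : (u : A) ∈ D) :
    (↑u⁻¹ : A) ∈ D := by
  let f : D →ₗ[k] D := LinearMap.mulLeft k ⟨u, hu⟩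
  have hf : Function.Injective f := fun x y h =>
    Subtype.ext (u.isUnit.mul_left_cancel (congrArg Subtype.val h))
  obtain ⟨b, hb⟩ := LinearMap.surjective_of_injective hf 1
  rw [Units.inv_eq_of_mul_eq_one_right (a := (b : A)) (congrArg Subtype.val hb)]
  exact b.2

/-- The Dyson transform of a pair of subspaces preserves the sum of the dimensions. -/
theorem finrank_dysonTransform (M N : Submodule k A) (u : Aˣ) :
    Module.finrank k ↥(M ⊓ N.comap (LinearMap.mulRight k (u : A))) +
      Module.finrank k ↥(N ⊔ M.map (LinearMap.mulRight k (u : A))) =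
        Module.finrank k M + Module.finrank k N := by
  set R := LinearMap.mulRight k (u : A)
  have hR : Function.Injective R := fun x y h => u.isUnit.mul_right_cancel h
  have hr (P : Submodule k A) : Module.finrank k (P.map R) = Module.finrank k P :=
    (P.equivMapOfInjective R hR).finrank_eq.symm
  have h : (M ⊓ N.comap R).map R = N ⊓ M.map R := by
    ext y
    simp only [Submodule.mem_map, Submodule.mem_inf, Submodule.mem_comap]
    constructor
    · rintro ⟨x, ⟨h1, h2⟩, rfl⟩
      exact ⟨h2, x, h1, rfl⟩
    · rintro ⟨h2, x, h1, rfl⟩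
      exact ⟨x, ⟨h1, h2⟩, rfl⟩
  rw [← hr (M ⊓ N.comap R), h, add_comm, Submodule.finrank_sup_add_finrank_inf_eq, hr, add_comm]

theorem exists_subalgebra_submodule_of_one_mem [Infinite k] (M N : Submodule k A)
    (h1 : (1 : A) ∈ M) (hM : ∀ x ∈ M, ∀ y ∈ M, x * y = y * x) (hN : ∃ u ∈ N, IsUnit u) :
    ∃ (B : Subalgebra k A) (V : Submodule k A),
      B ≤ Algebra.adjoin k (M : Set A) ∧ V ≤ M * N ∧ N ≤ V ∧
      (∀ b ∈ B, ∀ v ∈ V, b * v ∈ V) ∧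
      Module.finrank k M + Module.finrank k N ≤ Module.finrank k V + Module.finrank k B := by
  induction hn : Module.finrank k M using Nat.strong_induction_on generalizing M N with
  | _ n ih =>
    subst hn
    by_cases h : ∃ u : Aˣ, (u : A) ∈ N ∧ ¬ M ≤ N.comap (LinearMap.mulRight k (u : A))
    · obtain ⟨u, huN, hu⟩ := h
      have hlt : M ⊓ N.comap (LinearMap.mulRight k (u : A)) < M :=
        lt_of_le_of_ne inf_le_left fun h => hu (inf_eq_left.1 h)
      obtain ⟨B, V, hB, hV, hNV, hBV, hd⟩ := ih _ (Submodule.finrank_lt_finrank_of_lt hlt)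
        (M ⊓ N.comap (LinearMap.mulRight k (u : A)))
        (N ⊔ M.map (LinearMap.mulRight k (u : A))) ⟨h1, by simpa using huN⟩
        (fun x hx y hy => hM x hx.1 y hy.1) ⟨u, Submodule.mem_sup_left huN, u.isUnit⟩ rfl
      refine ⟨B, V, hB.trans (Algebra.adjoin_mono inf_le_left), hV.trans ?_,
        le_sup_left.trans hNV, hBV, (finrank_dysonTransform M N u).symm.trans_le hd⟩
      rw [Submodule.mul_sup, sup_le_iff]
      refine ⟨mul_le_mul_left inf_le_left N, Submodule.mul_le.2 ?_⟩
      rintro x ⟨hx, hx'⟩ _ ⟨y, hy, rfl⟩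
      rw [LinearMap.mulRight_apply, ← mul_assoc, hM x hx y hy, mul_assoc]
      exact Submodule.mul_mem_mul hy hx'
    · push Not at h
      have hMN : ∀ a ∈ M, ∀ x ∈ N, a * x ∈ N := by
        intro a ha x hx
        obtain ⟨_, huN, u, rfl⟩ := hN
        obtain ⟨t, w, hw⟩ := exists_isUnit_add_smul (k := k) x u.isUnit
        have hwN : (w : A) ∈ N := hw ▸ N.add_mem hx (N.smul_mem t huN)
        have h2 : a * w - t • (a * u) ∈ N := N.sub_mem (h w hwN ha) (N.smul_mem t (h u huN ha))
        rwa [hw, mul_add, mul_smul_comm, add_sub_cancel_right] at h2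
      refine ⟨Algebra.adjoin k (M : Set A), N, le_rfl, fun x hx => ?_, le_rfl, fun b hb => ?_, ?_⟩
      · simpa using Submodule.mul_mem_mul h1 hx
      · induction hb using Algebra.adjoin_induction with
        | mem x hx => exact hMN x hx
        | algebraMap r => exact fun v hv => by simpa [← Algebra.smul_def] using N.smul_mem r hv
        | add x y _ _ hx hy => exact fun v hv => add_mul x y v ▸ N.add_mem (hx v hv) (hy v hv)
        | mul x y _ _ hx hy => exact fun v hv => (mul_assoc x y v).symm ▸ hx _ (hy v hv)
      · rw [add_comm]
        exact Nat.add_le_add_left (Submodule.finrank_mono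
          (t := Subalgebra.toSubmodule (Algebra.adjoin k (M : Set A))) Algebra.subset_adjoin) _

end



theorem stmt_14 {k A : Type*} [Field k] [Infinite k] [Ring A] [Algebra k A]
    [FiniteDimensional k A]
    (S T : Set A) (hSfin : S.Finite) (hTfin : T.Finite)
    (hS0 : (0 : A) ∉ S) (hT0 : (0 : A) ∉ T)
    (hcomm : ∀ a ∈ S, ∀ a' ∈ S, a * a' = a' * a)
    (hSu : ∃ x ∈ Submodule.span k S, IsUnit x) (hTu : ∃ x ∈ Submodule.span k T, IsUnit x)
    (a : A) (haS : a ∈ Submodule.span k S) (ha : IsUnit a) :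
    ∃ (B : Subalgebra k A) (V : Submodule k A),
      (∀ x ∈ B, ∀ y ∈ B, x * y = y * x) ∧
      B ≤ Algebra.adjoin k S ∧
      V ≤ Submodule.span k (S * T) ∧
      (∃ v ∈ V, IsUnit v) ∧
      Submodule.span k ((B : Set A) * (V : Set A)) = V ∧
      Submodule.span k ({a} * T) ≤ V ∧
      Module.finrank k (Submodule.span k S) + Module.finrank k (Submodule.span k T) ≤
        Module.finrank k V + Module.finrank k B := by
  obtain ⟨a, rfl⟩ := ha
  set M := Submodule.span k S
  set N := Submodule.span k T
  have hMD : M ≤ Subalgebra.toSubmodule (Algebra.adjoin k S) := Algebra.span_le_adjoin k S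
  have hD : ∀ x ∈ Algebra.adjoin k S, ∀ y ∈ Algebra.adjoin k S, x * y = y * x := by
    have := Algebra.isMulCommutative_adjoin k hcomm
    exact fun x hx y hy => setLike_mul_comm hx hy
  have hinv := Subalgebra.units_inv_mem_of_mem _ a (hMD haS)
  let L : A →ₗ[k] A := LinearMap.mulLeft k (a : A)
  let L' : A →ₗ[k] A := LinearMap.mulLeft k (↑a⁻¹ : A)
  have hr (P : Submodule k A) : Module.finrank k (P.map L) = Module.finrank k P :=
    (P.equivMapOfInjective L fun x y h => a.isUnit.mul_left_cancel h).finrank_eq.symm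
  have hr' : Module.finrank k (M.map L') = Module.finrank k M :=
    (M.equivMapOfInjective L' fun x y h => a⁻¹.isUnit.mul_left_cancel h).finrank_eq.symm
  have hM'D : M.map L' ≤ Subalgebra.toSubmodule (Algebra.adjoin k S) := by
    rintro _ ⟨x, hx, rfl⟩
    exact (Algebra.adjoin k S).mul_mem hinv (hMD hx)
  obtain ⟨B, V, hB, hV, hNV, hBV, hd⟩ := exists_subalgebra_submodule_of_one_mem (M.map L') N
    ⟨a, haS, a.inv_mul⟩ (fun x hx y hy => hD x (hM'D hx) y (hM'D hy)) hTu
  have hBD : B ≤ Algebra.adjoin k S := hB.trans (Algebra.adjoin_le hM'D)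
  refine ⟨B, V.map L, fun x hx y hy => hD x (hBD hx) y (hBD hy), hBD, ?_, ?_, ?_, ?_, ?_⟩
  · rw [← Submodule.span_mul_span, Submodule.map_le_iff_le_comap]
    refine hV.trans (Submodule.mul_le.2 ?_)
    rintro _ ⟨x, hx, rfl⟩ y hy
    simpa [L, L', ← mul_assoc] using Submodule.mul_mem_mul hx hy
  · obtain ⟨u, hu, huu⟩ := hTu
    exact ⟨a * u, ⟨u, hNV hu, rfl⟩, a.isUnit.mul huu⟩
  · apply le_antisymm
    · rw [Submodule.span_le]
      rintro _ ⟨b, hb, _, ⟨v, hv, rfl⟩, rfl⟩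
      refine ⟨b * v, hBV b hb v hv, ?_⟩
      simp only [L, LinearMap.mulLeft_apply, ← mul_assoc]
      rw [hD _ (hMD haS) b (hBD hb)]
    · exact fun v hv => Submodule.subset_span ⟨1, one_mem B, v, hv, one_mul v⟩
  · rw [Submodule.span_le]
    rintro _ ⟨_, rfl, t, ht, rfl⟩
    exact ⟨t, hNV (Submodule.subset_span ht), rfl⟩
  · rwa [hr, ← hr']
end
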